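/- Let X be a set, n a positive integer, θ > 0, and S = ((x_1,y_1),…,(x_n,y_n)) a sequence in (X × {−1,+1})^n. Let H ⊆ {−1,+1}^X be a (finite or countable) hypothesis class whose dual VC dimension is at most d*, and let v = ∑_{h ∈ H} α_h·h with α_h ≥ 0 for all h ∈ H and ∑_{h ∈ H} α_h = 1. If v(x_i)·y_i ≥ θ for every i ∈ [n], then, setting L = ⌈130²·(4d* + 2)/θ²⌉, there exist h_1,…,h_L ∈ H with α_{h_j} > 0 for every j ∈ [L] such that the function ṽ = (1/L)·∑_{j=1}^L h_j satisfies ṽ(x_i)·y_i > 0 for every i ∈ [n]. -/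

import Mathlib

/-- A class `G` of `±1`-valued functions on `A` shatters the finite set `s` if every
`±1` labeling of `s` is realized by some `g ∈ G`. -/
def Shatters {A : Type*} (G : Set (A → ℝ)) (s : Finset A) : Prop :=
  ∀ σ : A → Bool, ∃ g ∈ G, ∀ a ∈ s, g a = (if σ a then (1 : ℝ) else -1)

/-- The dual class of `H`: evaluation functionals `h ↦ h x` for `x ∈ X`. -/
def dualClass {X : Type*} (H : Set (X → ℝ)) : Set (↥H → ℝ) :=
  {p | ∃ x : X, p = fun h => h.1 x}

namespace VotingPruning
open Finset
open scoped symmDiff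

open Classical in
/-- The real number `±1` encoding a proposition. -/
noncomputable def signOf (p : Prop) : ℝ := if p then 1 else -1

lemma sum_exp_signs {ι : Type*} [Fintype ι] [DecidableEq ι] (c : ι → ℝ) :
    ∑ ε : ι → Bool, Real.exp (∑ j, signOf (ε j) * c j) ≤
      2 ^ Fintype.card ι * Real.exp ((∑ j, c j ^ 2) / 2) := by
  have h1 : ∑ ε : ι → Bool, Real.exp (∑ j, signOf (ε j) * c j) =
      ∏ j, ∑ e : Bool, Real.exp (signOf e * c j) := by
    rw [Finset.prod_univ_sum, Fintype.piFinset_univ]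
    simp only [Real.exp_sum]
  have h2 : ∀ j, ∑ e : Bool, Real.exp (signOf e * c j) ≤ 2 * Real.exp (c j ^ 2 / 2) := by
    intro j
    have := Real.cosh_le_exp_half_sq (c j)
    rw [Real.cosh_eq] at this
    simp [signOf]
    linarith
  rw [h1]
  calc _ ≤ ∏ j, 2 * Real.exp (c j ^ 2 / 2) :=
        Finset.prod_le_prod (fun j _ => Finset.sum_nonneg fun _ _ => (Real.exp_pos _).le)
          fun j _ => h2 j
    _ = _ := by
        rw [Finset.prod_mul_distrib, ← Real.exp_sum, Finset.sum_div]
        simp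

/-- Finitely many Rademacher sums can be made small simultaneously. -/
lemma exists_signs_abs_sum_le {ι κ : Type*} [Fintype ι] (I : Finset κ) (b : κ → ι → ℝ)
    (r a : κ → ℝ) (hr : ∀ i ∈ I, 0 < r i) (ha : ∀ i ∈ I, 0 ≤ a i)
    (hb : ∀ i ∈ I, ∑ j, b i j ^ 2 ≤ r i ^ 2)
    (hsum : ∑ i ∈ I, 2 * Real.exp (-(a i ^ 2 / 2)) < 1) :
    ∃ ε : ι → Bool, ∀ i ∈ I, |∑ j, signOf (ε j) * b i j| ≤ r i * a i := by
  classical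
  by_contra! hcon
  let W : κ → (ι → Bool) → ℝ := fun i ε => ∑ j, signOf (ε j) * b i j
  let E : κ → ℝ → (ι → Bool) → ℝ := fun i s ε =>
    Real.exp (-a i ^ 2) * Real.exp (s * (a i / r i) * W i ε)
  have hE : ∀ i ∈ I, ∀ s : ℝ, s ^ 2 = 1 →
      ∑ ε, E i s ε ≤ 2 ^ Fintype.card ι * Real.exp (-(a i ^ 2 / 2)) := by
    intro i hi s hs
    have h := sum_exp_signs (fun j => s * (a i / r i) * b i j)
    have h3 : (∑ j, (s * (a i / r i) * b i j) ^ 2) / 2 ≤ a i ^ 2 / 2 := by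
      have : ∑ j, (s * (a i / r i) * b i j) ^ 2 = (a i / r i) ^ 2 * ∑ j, b i j ^ 2 := by
        rw [Finset.mul_sum]
        refine Finset.sum_congr rfl fun j _ => ?_
        rw [mul_pow, mul_pow, hs, one_mul]
      rw [this]
      have h4 := mul_le_mul_of_nonneg_left (hb i hi) (sq_nonneg (a i / r i))
      have h5 : (a i / r i) ^ 2 * r i ^ 2 = a i ^ 2 := by
        have := (hr i hi).ne'
        field_simp
      linarith
    calc ∑ ε, E i s ε
        = Real.exp (-a i ^ 2) *
            ∑ ε : ι → Bool, Real.exp (∑ j, signOf (ε j) * (s * (a i / r i) * b i j)) := by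
          rw [Finset.mul_sum]
          refine Finset.sum_congr rfl fun ε _ => ?_
          simp only [E, W]
          congr 2
          rw [Finset.mul_sum]
          exact Finset.sum_congr rfl fun j _ => by ring
      _ ≤ Real.exp (-a i ^ 2) * (2 ^ Fintype.card ι * Real.exp (a i ^ 2 / 2)) := by
          gcongr
          exact h.trans (by gcongr)
      _ = _ := by
          rw [mul_left_comm, ← Real.exp_add]
          congr 2
          ring
  have hlow : ∀ ε : ι → Bool, 1 ≤ ∑ i ∈ I, (E i 1 ε + E i (-1) ε) := by
    intro ε
    obtain ⟨i, hi, hlt⟩ := hcon ε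
    have hpos : ∀ i s, 0 < E i s ε := fun i s => by positivity
    have key : ∀ s : ℝ, r i * a i ≤ s * W i ε → 1 ≤ E i s ε := by
      intro s hs
      simp only [E]
      rw [← Real.exp_add]
      apply Real.one_le_exp
      have hri := hr i hi
      have : a i / r i * (r i * a i) ≤ a i / r i * (s * W i ε) :=
        mul_le_mul_of_nonneg_left hs (div_nonneg (ha i hi) hri.le)
      have h5 : a i / r i * (r i * a i) = a i ^ 2 := by
        have := hri.ne'
        field_simp
      nlinarith
    have h1 : 1 ≤ E i 1 ε + E i (-1) ε := by
      rcases le_abs'.1 hlt.le with h | h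
      · have := key (-1) (by simp only [W]; linarith)
        linarith [hpos i 1]
      · have := key 1 (by simp only [W]; linarith)
        linarith [hpos i (-1)]
    exact h1.trans (Finset.single_le_sum (f := fun i => E i 1 ε + E i (-1) ε)
      (fun i _ => (add_pos (hpos i 1) (hpos i (-1))).le) hi)
  have h1 : (2 : ℝ) ^ Fintype.card ι ≤ ∑ ε : ι → Bool, ∑ i ∈ I, (E i 1 ε + E i (-1) ε) := by
    calc (2 : ℝ) ^ Fintype.card ι = ∑ ε : ι → Bool, (1 : ℝ) := by simp
      _ ≤ _ := Finset.sum_le_sum fun ε _ => hlow ε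
  have h2 : ∑ ε : ι → Bool, ∑ i ∈ I, (E i 1 ε + E i (-1) ε) ≤
      2 ^ Fintype.card ι * ∑ i ∈ I, 2 * Real.exp (-(a i ^ 2 / 2)) := by
    rw [Finset.sum_comm, Finset.mul_sum]
    refine Finset.sum_le_sum fun i hi => ?_
    rw [Finset.sum_add_distrib]
    have := hE i hi 1 (by norm_num)
    have := hE i hi (-1) (by norm_num)
    linarith
  have h3 : (0 : ℝ) < 2 ^ Fintype.card ι := by positivity
  nlinarith

/-- A separated family of sets is separated by few of its coordinates. -/
lemma exists_small_separating {ι : Type*} [Fintype ι] [DecidableEq ι] [Nonempty ι]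
    (Q : Finset (Finset ι × Finset ι)) (δ : ℝ) (hδ : δ ≤ 1)
    (hQ : ∀ p ∈ Q, δ * Fintype.card ι ≤ #(p.1 ∆ p.2)) (m : ℕ) :
    ∃ s : Finset ι, #s ≤ m ∧
      (#{p ∈ Q | ∀ j ∈ s, j ∉ p.1 ∆ p.2} : ℝ) ≤ #Q * (1 - δ) ^ m := by
  induction m with
  | zero => exact ⟨∅, by simp, by simp⟩
  | succ m ih =>
    obtain ⟨s, hs, hcard⟩ := ih
    set R := {p ∈ Q | ∀ j ∈ s, j ∉ p.1 ∆ p.2} with hR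
    have hsum : ∑ j : ι, (#{p ∈ R | j ∉ p.1 ∆ p.2} : ℝ) ≤ ∑ j : ι, #R * (1 - δ) := by
      have hswap : ∑ j : ι, (#{p ∈ R | j ∉ p.1 ∆ p.2} : ℝ) =
          ∑ p ∈ R, (#{j : ι | j ∉ p.1 ∆ p.2} : ℝ) := by
        exact_mod_cast Finset.sum_card_bipartiteAbove_eq_sum_card_bipartiteBelow
          (s := (univ : Finset ι)) (t := R) (fun j p => j ∉ p.1 ∆ p.2)
      rw [hswap]
      have : ∀ p ∈ R, (#{j : ι | j ∉ p.1 ∆ p.2} : ℝ) ≤ Fintype.card ι * (1 - δ) := by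
        intro p hp
        have h1 : #{j : ι | j ∉ p.1 ∆ p.2} + #(p.1 ∆ p.2) = Fintype.card ι := by
          have := Finset.card_compl_add_card (p.1 ∆ p.2)
          rw [← this]
          congr 2
          ext j
          simp only [mem_filter, mem_univ, true_and, mem_compl]
        have h2 := hQ p (Finset.filter_subset _ _ hp)
        have h3 : (#{j : ι | j ∉ p.1 ∆ p.2} : ℝ) + #(p.1 ∆ p.2) = Fintype.card ι := by
          exact_mod_cast h1
        linarith
      refine (Finset.sum_le_sum this).trans (le_of_eq ?_)
      simp
      ring
    obtain ⟨j, -, hj⟩ := Finset.exists_le_of_sum_le Finset.univ_nonempty hsum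
    refine ⟨insert j s, (Finset.card_insert_le _ _).trans (by omega), ?_⟩
    have hset : {p ∈ Q | ∀ i ∈ insert j s, i ∉ p.1 ∆ p.2} = {p ∈ R | j ∉ p.1 ∆ p.2} := by
      ext p
      simp only [hR, Finset.mem_filter, Finset.forall_mem_insert]
      tauto
    rw [hset, pow_succ, ← mul_assoc]
    exact hj.trans (mul_le_mul_of_nonneg_right hcard (by linarith))

lemma sum_choose_le (d t : ℕ) (ht : 0 < t) :
    ((∑ i ∈ range (d + 1), (d * t).choose i : ℕ) : ℝ) ≤ (Real.exp 1 * t) ^ d := by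
  have ht' : (0 : ℝ) < t := by exact_mod_cast ht
  have hx : (t : ℝ)⁻¹ ≤ 1 := inv_le_one_of_one_le₀ (by exact_mod_cast ht)
  rcases Nat.eq_zero_or_pos d with rfl | hd
  · simp
  have h1 : ((∑ i ∈ range (d + 1), (d * t).choose i : ℕ) : ℝ) * (t : ℝ)⁻¹ ^ d ≤
      ((t : ℝ)⁻¹ + 1) ^ (d * t) := by
    rw [add_pow]
    push_cast
    rw [Finset.sum_mul]
    have hsub : range (d + 1) ⊆ range (d * t + 1) :=
      Finset.range_subset_range.2 (by nlinarith)
    refine le_trans (Finset.sum_le_sum fun i hi => ?_)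
      (Finset.sum_le_sum_of_subset_of_nonneg hsub fun i _ _ => by positivity)
    rw [one_pow, mul_one, mul_comm]
    gcongr ?_ * _
    exact pow_le_pow_of_le_one (by positivity) hx (by simpa [Nat.lt_succ_iff] using hi)
  have h2 : ((t : ℝ)⁻¹ + 1) ^ (d * t) ≤ Real.exp 1 ^ d := by
    calc ((t : ℝ)⁻¹ + 1) ^ (d * t) ≤ Real.exp ((t : ℝ)⁻¹) ^ (d * t) := by
          gcongr
          exact Real.add_one_le_exp _
      _ = Real.exp 1 ^ d := by
          rw [← Real.exp_nat_mul, ← Real.exp_nat_mul]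
          congr 1
          push_cast
          field_simp
  rw [mul_pow]
  have h3 := h1.trans h2
  rwa [inv_pow, ← div_eq_mul_inv, div_le_iff₀ (by positivity)] at h3

/-- A family of bounded VC dimension has few traces on a small set. -/
lemma card_traces_le {ι : Type*} [DecidableEq ι] (𝒜 : Finset (Finset ι)) (d t : ℕ) (ht : 0 < t)
    (hvc : ∀ s, 𝒜.Shatters s → #s ≤ d) (s : Finset ι) (hs : #s ≤ d * t)
    (hinj : Set.InjOn (fun S => S ∩ s) (𝒜 : Set (Finset ι))) :
    (#𝒜 : ℝ) ≤ (Real.exp 1 * t) ^ d := by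
  refine le_trans ?_ (sum_choose_le d t ht)
  norm_cast
  rw [← Finset.card_image_of_injOn hinj]
  refine (Finset.card_le_card_shatterer _).trans ?_
  have hsub : (𝒜.image fun S => S ∩ s).shatterer ⊆
      (range (d + 1)).biUnion fun i => powersetCard i s := by
    intro u hu
    rw [Finset.mem_shatterer] at hu
    have hus : u ⊆ s := by
      obtain ⟨v, hv, huv⟩ := hu (Finset.Subset.refl u)
      obtain ⟨w, -, rfl⟩ := Finset.mem_image.1 hv
      exact fun a ha => (Finset.mem_inter.1 (Finset.mem_inter.1 (huv.symm ▸ ha)).2).2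
    have hud : #u ≤ d := by
      refine hvc u fun v hv => ?_
      obtain ⟨w, hw, hvw⟩ := hu hv
      obtain ⟨z, hz, rfl⟩ := Finset.mem_image.1 hw
      refine ⟨z, hz, ?_⟩
      rw [← hvw]
      ext a
      have := @hus a
      simp only [Finset.mem_inter]
      tauto
    simp only [Finset.mem_biUnion, Finset.mem_range, Finset.mem_powersetCard]
    exact ⟨#u, by omega, hus, rfl⟩
  refine (Finset.card_le_card hsub).trans (Finset.card_biUnion_le.trans ?_)
  refine Finset.sum_le_sum fun i _ => ?_
  rw [Finset.card_powersetCard]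
  exact Nat.choose_le_choose i hs

lemma packing_numerics (k : ℕ) :
    ((32 : ℝ) * 16 ^ k) ^ 2 < Real.exp (6 * k + 7) ∧
      Real.exp 1 * (4 ^ k * (6 * k + 7) : ℕ) < 32 * 16 ^ k := by
  have he1 := Real.exp_one_gt_d9
  have he2 := Real.exp_one_lt_d9
  constructor
  · have h7 : (1024 : ℝ) < Real.exp 1 ^ 7 :=
      lt_of_lt_of_le (by norm_num) (pow_le_pow_left₀ (by norm_num : (0 : ℝ) ≤ 2.71) (by linarith) 7)
    have h6 : (256 : ℝ) ≤ Real.exp 1 ^ 6 :=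
      le_trans (by norm_num) (pow_le_pow_left₀ (by norm_num : (0 : ℝ) ≤ 2.71) (by linarith) 6)
    have hexp : Real.exp (6 * k + 7) = (Real.exp 1 ^ 6) ^ k * Real.exp 1 ^ 7 := by
      rw [← pow_mul, ← pow_add, ← Real.exp_nat_mul]
      congr 1
      push_cast
      ring
    have h16 : ((32 : ℝ) * 16 ^ k) ^ 2 = 256 ^ k * 1024 := by
      rw [mul_pow, ← pow_mul, mul_comm k 2, pow_mul]
      norm_num
      ring
    rw [hexp, h16]
    have := pow_le_pow_left₀ (by norm_num : (0 : ℝ) ≤ 256) h6 k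
    have hp : (0 : ℝ) < 256 ^ k := by positivity
    nlinarith
  · have h : (6 * k + 7 : ℝ) ≤ 7 * 4 ^ k := by
      induction k with
      | zero => norm_num
      | succ k ih =>
        have : (1 : ℝ) ≤ 4 ^ k := one_le_pow₀ (by norm_num)
        push_cast
        rw [pow_succ]
        linarith
    have h4 : (16 : ℝ) ^ k = 4 ^ k * 4 ^ k := by
      rw [← mul_pow]
      norm_num
    have hp : (0 : ℝ) < 4 ^ k := by positivity
    push_cast
    rw [h4]
    have h5 := mul_le_mul_of_nonneg_left h hp.le
    have h6 : (0 : ℝ) < 4 ^ k * 4 ^ k := by positivity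
    have h7 : Real.exp 1 * (4 ^ k * (6 * k + 7)) ≤ Real.exp 1 * (4 ^ k * (7 * 4 ^ k)) :=
      mul_le_mul_of_nonneg_left h5 (Real.exp_pos 1).le
    nlinarith

/-- A separated family of sets of bounded VC dimension has few members. -/
lemma card_lt_of_separated {ι : Type*} [Fintype ι] [DecidableEq ι] [Nonempty ι] (ℬ : Finset (Finset ι))
    (d : ℕ) (hd : 0 < d) (hvc : ∀ s, ℬ.Shatters s → #s ≤ d) (k : ℕ)
    (hsep : ∀ S ∈ ℬ, ∀ T ∈ ℬ, S ≠ T → (1 / 4 : ℝ) ^ k * Fintype.card ι ≤ #(S ∆ T)) :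
    (#ℬ : ℝ) < (32 * 16 ^ k) ^ d := by
  by_contra! hcon
  obtain ⟨hn1, hn2⟩ := packing_numerics k
  have hcon' : (32 * 16 ^ k) ^ d ≤ #ℬ := by exact_mod_cast hcon
  obtain ⟨𝒞, h𝒞, hcard⟩ := Finset.exists_subset_card_eq hcon'
  set t := 4 ^ k * (6 * k + 7) with ht
  have hδ1 : (1 / 4 : ℝ) ^ k ≤ 1 := pow_le_one₀ (by norm_num) (by norm_num)
  obtain ⟨s, hs, hrem⟩ := exists_small_separating 𝒞.offDiag ((1 / 4 : ℝ) ^ k) hδ1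
    (by
      rintro ⟨S, T⟩ h
      rw [Finset.mem_offDiag] at h
      exact hsep S (h𝒞 h.1) T (h𝒞 h.2.1) h.2.2) (d * t)
  have hcardR : (#𝒞 : ℝ) = (32 * 16 ^ k) ^ d := by exact_mod_cast hcard
  have hoff : (#𝒞.offDiag : ℝ) ≤ ((32 * 16 ^ k) ^ 2) ^ d := by
    rw [← pow_mul, mul_comm 2 d, pow_mul, ← hcardR, sq]
    rw [Finset.offDiag_card]
    exact_mod_cast Nat.sub_le _ _
  have hdecay : (1 - (1 / 4 : ℝ) ^ k) ^ (d * t) ≤ (Real.exp (-(6 * k + 7))) ^ d := by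
    rw [mul_comm, pow_mul]
    refine pow_le_pow_left₀ (pow_nonneg (by linarith) _) ?_ d
    calc (1 - (1 / 4 : ℝ) ^ k) ^ t ≤ Real.exp (-(1 / 4 : ℝ) ^ k) ^ t :=
          pow_le_pow_left₀ (by linarith) (Real.one_sub_le_exp_neg _) t
      _ = Real.exp (-(6 * k + 7)) := by
          rw [← Real.exp_nat_mul, ht]
          congr 1
          push_cast
          have : (4 : ℝ) ^ k * (1 / 4) ^ k = 1 := by
            rw [← mul_pow]
            norm_num
          linear_combination (-(6 * k + 7) : ℝ) * this
  have hlt : (#{p ∈ 𝒞.offDiag | ∀ j ∈ s, j ∉ p.1 ∆ p.2} : ℝ) < 1 := by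
    refine hrem.trans_lt ?_
    calc _ ≤ ((32 * 16 ^ k : ℝ) ^ 2) ^ d * (Real.exp (-(6 * k + 7))) ^ d :=
          mul_le_mul hoff hdecay (pow_nonneg (by linarith) _) (by positivity)
      _ = ((32 * 16 ^ k : ℝ) ^ 2 * Real.exp (-(6 * k + 7))) ^ d := (mul_pow _ _ _).symm
      _ < 1 := by
          refine pow_lt_one₀ (by positivity) ?_ hd.ne'
          rw [Real.exp_neg, ← div_eq_mul_inv, div_lt_one (Real.exp_pos _)]
          exact hn1
  have hempty : {p ∈ 𝒞.offDiag | ∀ j ∈ s, j ∉ p.1 ∆ p.2} = ∅ := by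
    rw [← Finset.card_eq_zero]
    exact Nat.lt_one_iff.1 (by exact_mod_cast hlt)
  have hinj : Set.InjOn (fun S => S ∩ s) (𝒞 : Set (Finset ι)) := by
    intro S hS T hT hST
    by_contra hne
    have hmem : (S, T) ∈ ({p ∈ 𝒞.offDiag | ∀ j ∈ s, j ∉ p.1 ∆ p.2}) := by
      rw [Finset.mem_filter, Finset.mem_offDiag]
      refine ⟨⟨hS, hT, hne⟩, fun j hj => ?_⟩
      have := Finset.ext_iff.1 hST j
      simp only [Finset.mem_inter, hj, and_true] at this
      rw [Finset.mem_symmDiff]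
      tauto
    rw [hempty] at hmem
    exact Finset.notMem_empty _ hmem
  have hle := card_traces_le 𝒞 d t (by positivity) (fun u hu => hvc u (hu.mono_left h𝒞)) s hs hinj
  rw [hcardR] at hle
  exact absurd hle (not_le.2 (pow_lt_pow_left₀ hn2 (by positivity) hd.ne.symm))

/-- Maximal separated subfamilies are nets. -/
lemma exists_separated_net {ι : Type*} [DecidableEq ι] (𝒜 : Finset (Finset ι)) (ρ : ℝ) (hρ : 0 ≤ ρ) :
    ∃ ℬ ⊆ 𝒜, (∀ S ∈ ℬ, ∀ T ∈ ℬ, S ≠ T → ρ ≤ #(S ∆ T)) ∧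
      ∀ S ∈ 𝒜, ∃ T ∈ ℬ, (#(S ∆ T) : ℝ) ≤ ρ := by
  obtain ⟨ℬ, hℬ, hmax⟩ := Finset.exists_max_image
    {ℬ ∈ 𝒜.powerset | ∀ S ∈ ℬ, ∀ T ∈ ℬ, S ≠ T → ρ ≤ #(S ∆ T)} Finset.card ⟨∅, by simp⟩
  simp only [Finset.mem_filter, Finset.mem_powerset] at hℬ hmax
  refine ⟨ℬ, hℬ.1, hℬ.2, fun S hS => ?_⟩
  by_contra! hcon
  have hSℬ : S ∉ ℬ := fun h => by
    have := hcon S h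
    simp at this
    linarith
  have := hmax (insert S ℬ) ⟨Finset.insert_subset hS hℬ.1, by
    intro U hU V hV hne
    rw [Finset.mem_insert] at hU hV
    rcases hU with rfl | hU <;> rcases hV with rfl | hV
    · exact absurd rfl hne
    · exact (hcon V hV).le
    · rw [symmDiff_comm]
      exact (hcon U hU).le
    · exact hℬ.2 U hU V hV hne⟩
  rw [Finset.card_insert_of_notMem hSℬ] at this
  omega

/-- The difference of the two halves of the `±1` indicator of `S`. -/
noncomputable def halfDiff {ι : Type*} (S : Finset (Bool × ι)) (j : ι) : ℝ :=
  signOf ((true, j) ∈ S) - signOf ((false, j) ∈ S)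

lemma sum_halfDiff_sub_sq_le {ι : Type*} [Fintype ι] [DecidableEq ι] (S T : Finset (Bool × ι)) :
    ∑ j, (halfDiff S j - halfDiff T j) ^ 2 ≤ 8 * #(S ∆ T) := by
  have hpt : ∀ p : Bool × ι, (signOf (p ∈ S) - signOf (p ∈ T)) ^ 2 =
      if p ∈ S ∆ T then 4 else 0 := by
    intro p
    by_cases h1 : p ∈ S <;> by_cases h2 : p ∈ T <;>
      simp [signOf, h1, h2, Finset.mem_symmDiff] <;> norm_num
  have hsum : ∑ p : Bool × ι, (signOf (p ∈ S) - signOf (p ∈ T)) ^ 2 = 4 * #(S ∆ T) := by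
    simp only [hpt]
    rw [Finset.sum_ite_mem, Finset.univ_inter, Finset.sum_const, nsmul_eq_mul, mul_comm]
  rw [Fintype.sum_prod_type, Fintype.sum_bool, ← Finset.sum_add_distrib] at hsum
  calc _ ≤ ∑ j, 2 * ((signOf ((true, j) ∈ S) - signOf ((true, j) ∈ T)) ^ 2 +
        (signOf ((false, j) ∈ S) - signOf ((false, j) ∈ T)) ^ 2) := by
        refine Finset.sum_le_sum fun j _ => ?_
        unfold halfDiff
        nlinarith [sq_nonneg ((signOf ((true, j) ∈ S) - signOf ((true, j) ∈ T)) +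
          (signOf ((false, j) ∈ S) - signOf ((false, j) ∈ T)))]
    _ = _ := by
        rw [← Finset.mul_sum, hsum]
        ring

lemma sum_halfDiff_sq_le {ι : Type*} [Fintype ι] (S : Finset (Bool × ι)) :
    ∑ j, halfDiff S j ^ 2 ≤ 4 * Fintype.card ι := by
  calc ∑ j, halfDiff S j ^ 2 ≤ ∑ j : ι, 4 := by
        refine Finset.sum_le_sum fun j _ => ?_
        unfold halfDiff signOf
        split_ifs <;> norm_num
    _ = _ := by
        simp
        ring

/-- Chaining: a set system of VC dimension `d` on `M` pairs of points has a choice of signs,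
one for each pair, of discrepancy `O(√(d M))`. -/
lemma exists_signs_discrepancy {ι : Type*} [Fintype ι] [DecidableEq ι] [Nonempty ι]
    (𝒜 : Finset (Finset (Bool × ι))) (d : ℕ) (hd : 0 < d)
    (hvc : ∀ s, 𝒜.Shatters s → #s ≤ d) :
    ∃ ε : ι → Bool, ∀ S ∈ 𝒜, |∑ j, signOf (ε j) * halfDiff S j| ≤
      80 * √(d * Fintype.card ι) := by
  set M : ℝ := (Fintype.card ι : ℝ) with hM
  have hM0 : 0 < M := by
    rw [hM]
    exact_mod_cast Fintype.card_pos
  have hd0 : (1 : ℝ) ≤ d := by exact_mod_cast hd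
  have hcard : (Fintype.card (Bool × ι) : ℝ) = 2 * M := by simp [hM]
  choose net hsub hsep hnet using fun k : ℕ =>
    exists_separated_net 𝒜 ((1 / 4 : ℝ) ^ k * Fintype.card (Bool × ι)) (by positivity)
  choose! par hpar hdist using hnet
  obtain ⟨K, hK⟩ : ∃ K : ℕ, (1 / 4 : ℝ) ^ K * Fintype.card (Bool × ι) < 1 := by
    obtain ⟨K, hK⟩ := exists_pow_lt_of_lt_one
      (show (0 : ℝ) < (Fintype.card (Bool × ι) : ℝ)⁻¹ by rw [hcard]; positivity)
      (show (1 / 4 : ℝ) < 1 by norm_num)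
    refine ⟨K, ?_⟩
    have hpos : (0 : ℝ) < Fintype.card (Bool × ι) := by rw [hcard]; positivity
    calc _ < (Fintype.card (Bool × ι) : ℝ)⁻¹ * Fintype.card (Bool × ι) := by gcongr
      _ = 1 := inv_mul_cancel₀ hpos.ne'
  let b : (Σ _ : ℕ, Finset (Bool × ι)) → ι → ℝ := fun p j =>
    halfDiff p.2 j - match p.1 with
      | 0 => 0
      | k + 1 => halfDiff (par k p.2) j
  let r : (Σ _ : ℕ, Finset (Bool × ι)) → ℝ := fun p => 8 * √M * (1 / 2) ^ p.1
  let a : (Σ _ : ℕ, Finset (Bool × ι)) → ℝ := fun p => √d * (4 + p.1)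
  have hr2 : ∀ p, r p ^ 2 = 64 * M * (1 / 4) ^ p.1 := by
    intro p
    simp only [r]
    rw [mul_pow, mul_pow, Real.sq_sqrt hM0.le, ← pow_mul, mul_comm p.1 2, pow_mul]
    norm_num
  have hlevel : ∀ k, (#(net k) : ℝ) * (2 * Real.exp (-((√d * (4 + k)) ^ 2 / 2))) ≤
      (1 / 2) ^ (k + 1) := by
    intro k
    have h1 := (card_lt_of_separated (net k) d hd
      (fun s hs => hvc s (hs.mono_left (hsub k))) k (hsep k)).le
    have h2 : ((32 : ℝ) * 16 ^ k) ^ d ≤ Real.exp (d * (4 * k + 5)) := by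
      have he : (2 : ℝ) ≤ Real.exp 1 := by linarith [Real.exp_one_gt_d9]
      have : (32 : ℝ) * 16 ^ k = 2 ^ (4 * k + 5) := by
        rw [pow_add, pow_mul]
        norm_num
        ring
      rw [this]
      calc _ ≤ (Real.exp 1 ^ (4 * k + 5)) ^ d := by gcongr
        _ = _ := by
          rw [← Real.exp_nat_mul, ← Real.exp_nat_mul]
          congr 1
          push_cast
          ring
    have h3 : (√d * (4 + k)) ^ 2 = d * (4 + k) ^ 2 := by
      rw [mul_pow, Real.sq_sqrt (by positivity)]
    have he : (2 : ℝ) ≤ Real.exp 1 := by linarith [Real.exp_one_gt_d9]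
    calc _ ≤ Real.exp (d * (4 * k + 5)) * (Real.exp 1 * Real.exp (-((√d * (4 + k)) ^ 2 / 2))) := by
          gcongr
          exact h1.trans h2
      _ = Real.exp (d * (4 * k + 5) + (1 + -((√d * (4 + k)) ^ 2 / 2))) := by
          rw [Real.exp_add, Real.exp_add]
      _ ≤ Real.exp (-(k + 1 : ℕ)) := by
          apply Real.exp_le_exp.2
          rw [h3]
          push_cast
          have hk : (0 : ℝ) ≤ k := Nat.cast_nonneg k
          have h5 : (d : ℝ) * (3 + (k : ℝ) ^ 2 / 2) ≥ 1 * (3 + (k : ℝ) ^ 2 / 2) := by gcongr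
          nlinarith [sq_nonneg ((k : ℝ) - 1)]
      _ ≤ (1 / 2) ^ (k + 1) := by
          rw [Real.exp_neg, one_div, inv_pow]
          gcongr
          rw [show ((k + 1 : ℕ) : ℝ) = (k + 1 : ℕ) * 1 by ring, Real.exp_nat_mul]
          gcongr
  have hsum : ∑ p ∈ (range (K + 1)).sigma net, 2 * Real.exp (-(a p ^ 2 / 2)) < 1 := by
    rw [Finset.sum_sigma]
    simp only [a, Finset.sum_const, nsmul_eq_mul]
    refine (Finset.sum_le_sum fun k _ => hlevel k).trans_lt ?_
    have : ∀ n, ∑ k ∈ range n, (1 / 2 : ℝ) ^ (k + 1) = 1 - (1 / 2) ^ n := by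
      intro n
      induction n with
      | zero => simp
      | succ n ih =>
        rw [Finset.sum_range_succ, ih, pow_succ]
        ring
    rw [this]
    have : (0 : ℝ) < (1 / 2) ^ (K + 1) := by positivity
    linarith
  obtain ⟨ε, hε⟩ := exists_signs_abs_sum_le ((range (K + 1)).sigma net) b r a
    (fun p _ => by positivity) (fun p _ => by positivity)
    (by
      rintro ⟨k, S⟩ hp
      rw [Finset.mem_sigma] at hp
      rw [hr2]
      cases k with
      | zero =>
        have := sum_halfDiff_sq_le S
        simp only [b, sub_zero, pow_zero, mul_one]
        linarith
      | succ k =>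
        have h1 := sum_halfDiff_sub_sq_le S (par k S)
        have h2 := hdist k S (hsub _ hp.2)
        rw [hcard] at h2
        simp only [b]
        rw [pow_succ]
        linarith) hsum
  refine ⟨ε, ?_⟩
  have hchain : ∀ k ≤ K, ∀ S ∈ net k, |∑ j, signOf (ε j) * halfDiff S j| ≤
      8 * √M * √d * (10 - (6 + k) * (1 / 2) ^ k) := by
    intro k
    induction k with
    | zero =>
      intro _ S hS
      have := hε ⟨0, S⟩ (by simp [hS])
      simp only [b, r, a, sub_zero] at this
      refine this.trans (le_of_eq ?_)
      push_cast
      ring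
    | succ k ih =>
      intro hk S hS
      have h1 := hε ⟨k + 1, S⟩ (by simp [hS]; omega)
      have h2 := ih (by omega) (par k S) (hpar k S (hsub _ hS))
      simp only [b, r, a, mul_sub, Finset.sum_sub_distrib] at h1
      have h3 := abs_sub_abs_le_abs_sub (∑ j, signOf (ε j) * halfDiff S j)
        (∑ j, signOf (ε j) * halfDiff (par k S) j)
      have h4 : 8 * √M * √d * (10 - (6 + (k + 1 : ℕ)) * (1 / 2) ^ (k + 1)) =
          8 * √M * √d * (10 - (6 + k) * (1 / 2) ^ k) +
            8 * √M * (1 / 2) ^ (k + 1) * (√d * (4 + (k + 1 : ℕ))) := by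
        rw [pow_succ]
        push_cast
        ring
      linarith
  intro S hS
  have h1 := hdist K S hS
  have h2 : #(S ∆ par K S) = 0 := by
    apply Nat.lt_one_iff.1
    exact_mod_cast h1.trans_lt hK
  have h3 : S = par K S := by
    rw [Finset.card_eq_zero] at h2
    exact symmDiff_eq_bot.1 h2
  have h4 := hchain K le_rfl S (h3 ▸ hpar K S hS)
  refine h4.trans ?_
  rw [Real.sqrt_mul (by positivity)]
  have : (0 : ℝ) ≤ √M * √d * ((6 + K) * (1 / 2) ^ K) := by positivity
  nlinarith

/-- The traces of a set system along a map have VC dimension bounded by that of the system. -/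
lemma card_le_of_shatters_traces {A ι κ : Type*} [Fintype ι] [DecidableEq ι] [Fintype κ]
    (C : κ → Set A) (d : ℕ)
    (hC : ∀ s : Finset A, (∀ t ⊆ s, ∃ i, ∀ a ∈ s, a ∈ C i ↔ a ∈ t) → #s ≤ d)
    (f : ι → A) (𝒜 : Finset (Finset ι))
    (h𝒜 : ∀ S ∈ 𝒜, ∃ i, ∀ p, p ∈ S ↔ f p ∈ C i) (s : Finset ι) (hs : 𝒜.Shatters s) :
    #s ≤ d := by
  classical
  have key : ∀ t ⊆ s, ∃ i, ∀ p ∈ s, f p ∈ C i ↔ p ∈ t := by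
    intro t ht
    obtain ⟨u, hu, rfl⟩ := hs ht
    obtain ⟨i, hi⟩ := h𝒜 u hu
    exact ⟨i, fun p hp => by simp [← hi, hp]⟩
  have hinj : Set.InjOn f s := by
    intro p hp q hq hpq
    obtain ⟨i, hi⟩ := key {p} (by simpa using hp)
    have h1 := hi p hp
    have h2 := hi q hq
    rw [hpq] at h1
    simp only [Finset.mem_singleton] at h1 h2
    exact (h2.1 (h1.2 trivial)).symm
  rw [← Finset.card_image_of_injOn hinj]
  refine hC _ fun t _ => ?_
  obtain ⟨i, hi⟩ := key {p ∈ s | f p ∈ t} (Finset.filter_subset _ _)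
  refine ⟨i, fun a ha => ?_⟩
  obtain ⟨p, hp, rfl⟩ := Finset.mem_image.1 ha
  simpa [hp] using hi p hp

/-- Halving a sample indexed by pairs, keeping one member of each pair. -/
lemma exists_half {A ι κ : Type*} [Fintype ι] [Nonempty ι] [Fintype κ]
    (C : κ → Set A) (d : ℕ) (hd : 0 < d)
    (hC : ∀ s : Finset A, (∀ t ⊆ s, ∃ i, ∀ a ∈ s, a ∈ C i ↔ a ∈ t) → #s ≤ d)
    (f : Bool × ι → A) :
    ∃ g : ι → A, ∀ i, |∑ j, signOf (g j ∈ C i) - (∑ p, signOf (f p ∈ C i)) / 2| ≤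
      40 * √(d * Fintype.card ι) := by
  classical
  let 𝒜 : Finset (Finset (Bool × ι)) := univ.image fun i => univ.filter fun p => f p ∈ C i
  obtain ⟨ε, hε⟩ := exists_signs_discrepancy 𝒜 d hd
    (card_le_of_shatters_traces C d hC f 𝒜 (by
      intro S hS
      obtain ⟨i, -, rfl⟩ := Finset.mem_image.1 hS
      exact ⟨i, fun p => by simp⟩))
  refine ⟨fun j => f (ε j, j), fun i => ?_⟩
  have h := hε (univ.filter fun p => f p ∈ C i) (Finset.mem_image_of_mem (fun i => univ.filter fun p => f p ∈ C i) (mem_univ i))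
  have hpt : ∀ j, signOf (f (ε j, j) ∈ C i) =
      (signOf (f (true, j) ∈ C i) + signOf (f (false, j) ∈ C i)) / 2 +
        signOf (ε j) * halfDiff {p | f p ∈ C i} j / 2 := by
    intro j
    simp only [halfDiff, Finset.mem_filter, Finset.mem_univ, true_and]
    cases ε j <;> simp [signOf] <;> ring
  have heq : ∑ j, signOf (f (ε j, j) ∈ C i) - (∑ p, signOf (f p ∈ C i)) / 2 =
      (∑ j, signOf (ε j) * halfDiff {p | f p ∈ C i} j) / 2 := by
    simp only [hpt]
    rw [Fintype.sum_prod_type, Fintype.sum_bool, Finset.sum_add_distrib, ← Finset.sum_div,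
      ← Finset.sum_div, Finset.sum_add_distrib]
    ring
  rw [heq, abs_div, abs_two]
  linarith

/-- Repeated halving of a large sample. -/
lemma exists_subsample {A κ : Type*} [Fintype κ] (C : κ → Set A) (d : ℕ) (hd : 0 < d)
    (hC : ∀ s : Finset A, (∀ t ⊆ s, ∃ i, ∀ a ∈ s, a ∈ C i ↔ a ∈ t) → #s ≤ d)
    (L : ℕ) (hL : 0 < L) (k : ℕ) {ι : Type} [Fintype ι] (hι : Fintype.card ι = 2 ^ k * L)
    (f : ι → A) :
    ∃ g : Fin L → A, ∀ i,
      |(∑ j, signOf (g j ∈ C i)) / L - (∑ p, signOf (f p ∈ C i)) / (2 ^ k * L)| ≤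
        140 * √(d / L) * (1 - (5 / 7) ^ k) := by
  have hL0 : (0 : ℝ) < L := by exact_mod_cast hL
  induction k generalizing ι with
  | zero =>
    have e : Fin L ≃ ι := Fintype.equivOfCardEq (by simp [hι])
    refine ⟨f ∘ e, fun i => ?_⟩
    simp [Equiv.sum_comp e fun p => signOf (f p ∈ C i)]
  | succ k ih =>
    have e : Bool × Fin (2 ^ k * L) ≃ ι := Fintype.equivOfCardEq (by
      simp only [Fintype.card_prod, Fintype.card_bool, Fintype.card_fin, hι]
      ring)
    have : NeZero (2 ^ k * L) := ⟨by positivity⟩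
    obtain ⟨f', hf'⟩ := exists_half C d hd hC (f ∘ e)
    obtain ⟨g, hg⟩ := ih (ι := Fin (2 ^ k * L)) (by simp) f'
    refine ⟨g, fun i => ?_⟩
    have h1 := hf' i
    have h2 := hg i
    have hsum : ∑ p, signOf ((f ∘ e) p ∈ C i) = ∑ p, signOf (f p ∈ C i) :=
      Equiv.sum_comp e fun p => signOf (f p ∈ C i)
    rw [hsum, Fintype.card_fin] at h1
    set a := ∑ j, signOf (f' j ∈ C i)
    set b := ∑ p, signOf (f p ∈ C i)
    have hM : (0 : ℝ) < 2 ^ k * L := by positivity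
    have hpow : √((d : ℝ) * (2 ^ k * L : ℕ)) ≤ 2 ^ k * L * (√(d / L) * (5 / 7) ^ k) := by
      apply Real.sqrt_le_iff.2
      refine ⟨by positivity, ?_⟩
      have hq : (1 : ℝ) ≤ 2 ^ k * ((5 / 7) ^ k) ^ 2 := by
        rw [← pow_mul, mul_comm k 2, pow_mul, ← mul_pow]
        exact one_le_pow₀ (by norm_num)
      have hdl : √((d : ℝ) / L) ^ 2 = d / L := Real.sq_sqrt (by positivity)
      calc (d : ℝ) * (2 ^ k * L : ℕ) = d * (2 ^ k * L) * 1 := by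
            push_cast
            ring
        _ ≤ d * (2 ^ k * L) * (2 ^ k * ((5 / 7) ^ k) ^ 2) := by gcongr
        _ = (2 ^ k * L) ^ 2 * ((d / L) * ((5 / 7) ^ k) ^ 2) := by field_simp
        _ = _ := by rw [mul_pow (2 ^ k * L : ℝ), mul_pow √((d : ℝ) / L), hdl]
    have h3 : |a / (2 ^ k * L) - b / (2 ^ (k + 1) * L)| ≤ 40 * (√(d / L) * (5 / 7) ^ k) := by
      have : a / (2 ^ k * L) - b / (2 ^ (k + 1) * L) = (a - b / 2) / (2 ^ k * L) := by
        rw [pow_succ]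
        field_simp
      rw [this, abs_div, abs_of_pos hM, div_le_iff₀ hM]
      linarith
    refine (abs_sub_le _ (a / (2 ^ k * L)) _).trans ((add_le_add h2 h3).trans (le_of_eq ?_))
    rw [pow_succ]
    ring

/-- A finitely supported subprobability is approximated by uniform samples. -/
lemma exists_uniform_approx {A : Type*} (F : Finset A) (a₀ : A) (w : A → ℝ)
    (hw : ∀ a ∈ F, 0 ≤ w a) (hw1 : ∑ a ∈ F, w a ≤ 1) (N : ℕ) :
    ∃ f : Fin N → A, ∀ s : A → ℝ, (∀ a, |s a| ≤ 1) →
      |∑ p, s (f p) - N * ∑ a ∈ F, w a * s a| ≤ 2 * #F + N * (1 - ∑ a ∈ F, w a) := by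
  let c : A → ℕ := fun a => ⌊N * w a⌋₊
  have hc : ∀ a ∈ F, (c a : ℝ) ≤ N * w a := fun a ha =>
    Nat.floor_le (mul_nonneg (Nat.cast_nonneg _) (hw a ha))
  have hc' : ∀ a, N * w a ≤ c a + 1 := fun a => (Nat.lt_floor_add_one _).le
  have hcN : ∑ a ∈ F, c a ≤ N := by
    have : (∑ a ∈ F, (c a : ℝ)) ≤ N := by
      refine (Finset.sum_le_sum hc).trans ?_
      rw [← Finset.mul_sum]
      exact mul_le_of_le_one_right (Nat.cast_nonneg _) hw1
    exact_mod_cast this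
  obtain ⟨R, hR⟩ := Nat.exists_eq_add_of_le hcN
  have hRr : (N : ℝ) = ∑ a ∈ F, (c a : ℝ) + R := by exact_mod_cast hR
  have e : Fin N ≃ (Σ a : F, Fin (c a)) ⊕ Fin R := Fintype.equivOfCardEq (by
    simp only [Fintype.card_fin, Fintype.card_sum, Fintype.card_sigma]
    rw [Finset.sum_coe_sort F c, ← hR])
  let f' : (Σ a : F, Fin (c a)) ⊕ Fin R → A := Sum.elim (fun p => p.1) fun _ => a₀
  refine ⟨f' ∘ e, fun s hs => ?_⟩
  have hsum : ∑ p, s ((f' ∘ e) p) = ∑ a ∈ F, c a * s a + R * s a₀ := by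
    rw [show ∑ p, s ((f' ∘ e) p) = ∑ p, s (f' p) from Equiv.sum_comp e fun p => s (f' p)]
    rw [Fintype.sum_sum_type, Fintype.sum_sigma]
    simp only [f', Sum.elim_inl, Sum.elim_inr, Finset.sum_const, Finset.card_univ,
      Fintype.card_fin, nsmul_eq_mul]
    rw [Finset.sum_coe_sort F fun a => (c a : ℝ) * s a]
  have h1 : |∑ a ∈ F, c a * s a - N * ∑ a ∈ F, w a * s a| ≤ #F := by
    rw [Finset.mul_sum, ← Finset.sum_sub_distrib]
    refine (Finset.abs_sum_le_sum_abs _ _).trans ?_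
    calc _ ≤ ∑ a ∈ F, (1 : ℝ) := by
          refine Finset.sum_le_sum fun a ha => ?_
          rw [← mul_assoc, ← sub_mul, abs_mul]
          refine mul_le_one₀ ?_ (abs_nonneg _) (hs a)
          rw [abs_le]
          constructor <;> linarith [hc a ha, hc' a]
      _ = #F := by simp
  have h2 : (R : ℝ) ≤ #F + N * (1 - ∑ a ∈ F, w a) := by
    have : N * ∑ a ∈ F, w a ≤ ∑ a ∈ F, (c a : ℝ) + #F := by
      rw [Finset.mul_sum]
      refine (Finset.sum_le_sum fun a _ => hc' a).trans (le_of_eq ?_)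
      rw [Finset.sum_add_distrib]
      simp
    linarith
  have h3 : |R * s a₀| ≤ R := by
    rw [abs_mul, Nat.abs_cast]
    exact mul_le_of_le_one_right (Nat.cast_nonneg _) (hs a₀)
  rw [hsum, add_sub_right_comm]
  refine (abs_add_le _ _).trans ?_
  linarith

/-- Uniform samples of size `L` from a probability on `A` approximate the measures of all members
of a set system of VC dimension `d`, up to `O(√(d / L))`. -/
lemma exists_sample {A κ : Type*} [Fintype κ] (C : κ → Set A) (d : ℕ) (hd : 0 < d)
    (hC : ∀ s : Finset A, (∀ t ⊆ s, ∃ i, ∀ a ∈ s, a ∈ C i ↔ a ∈ t) → #s ≤ d)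
    (w : A → ℝ) (hw : ∀ a, 0 ≤ w a) (hw1 : HasSum w 1) (v : κ → ℝ)
    (hv : ∀ i, HasSum (fun a => w a * signOf (a ∈ C i)) (v i))
    (L : ℕ) (hL : 0 < L) (η : ℝ) (hη : 0 < η) :
    ∃ g : Fin L → A, ∀ i, |(∑ j, signOf (g j ∈ C i)) / L - v i| ≤ 140 * √(d / L) + η := by
  have hL0 : (0 : ℝ) < L := by exact_mod_cast hL
  have hA : Nonempty A := by
    by_contra h
    rw [not_nonempty_iff] at h
    exact one_ne_zero (hw1.unique hasSum_empty)
  obtain ⟨a₀⟩ := hA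
  obtain ⟨F, hF1, hFv⟩ : ∃ F : Finset A, 1 - η / 3 < ∑ a ∈ F, w a ∧
      ∀ i, |∑ a ∈ F, w a * signOf (a ∈ C i) - v i| < η / 3 := by
    have h1 := (tendsto_order.1 hw1).1 (1 - η / 3) (by linarith)
    have h2 : ∀ i, ∀ᶠ F : Finset A in Filter.atTop,
        |∑ a ∈ F, w a * signOf (a ∈ C i) - v i| < η / 3 := fun i =>
      Metric.tendsto_nhds.1 (hv i) (η / 3) (by linarith)
    exact (h1.and (Filter.eventually_all.2 h2)).exists
  have hle : ∑ a ∈ F, w a ≤ 1 := sum_le_hasSum F (fun a _ => hw a) hw1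
  obtain ⟨k, hk⟩ := pow_unbounded_of_one_lt (2 * #F / (η / 3)) (one_lt_two (α := ℝ))
  obtain ⟨f, hf⟩ := exists_uniform_approx F a₀ w (fun a _ => hw a) hle (2 ^ k * L)
  obtain ⟨g, hg⟩ := exists_subsample C d hd hC L hL k (by simp) f
  refine ⟨g, fun i => ?_⟩
  have h1 := hg i
  have h2 := hf (fun a => signOf (a ∈ C i)) (fun a => by unfold signOf; split_ifs <;> simp)
  have h3 := hFv i
  push_cast at h2
  have hN : (0 : ℝ) < 2 ^ k * L := by positivity
  have h4 : |(∑ p, signOf (f p ∈ C i)) / (2 ^ k * L) - ∑ a ∈ F, w a * signOf (a ∈ C i)| ≤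
      2 * (η / 3) := by
    have heq : (∑ p, signOf (f p ∈ C i)) / (2 ^ k * L) - ∑ a ∈ F, w a * signOf (a ∈ C i) =
        (∑ p, signOf (f p ∈ C i) - 2 ^ k * L * ∑ a ∈ F, w a * signOf (a ∈ C i)) /
          (2 ^ k * L) := by
      field_simp
    rw [heq, abs_div, abs_of_pos hN, div_le_iff₀ hN]
    refine h2.trans ?_
    rw [div_lt_iff₀ (by positivity)] at hk
    have hL1 : (1 : ℝ) ≤ L := by exact_mod_cast hL
    have h5 : (2 : ℝ) ^ k * (η / 3) * 1 ≤ 2 ^ k * (η / 3) * L := by gcongr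
    have h6 : (2 : ℝ) ^ k * L * (1 - ∑ a ∈ F, w a) ≤ 2 ^ k * L * (η / 3) := by
      gcongr
      linarith
    linarith
  have h5 : 140 * √((d : ℝ) / L) * (1 - (5 / 7) ^ k) ≤ 140 * √(d / L) :=
    mul_le_of_le_one_right (by positivity) (by linarith [show (0 : ℝ) < (5 / 7) ^ k by positivity])
  have h6 := abs_sub_le ((∑ j, signOf (g j ∈ C i)) / L)
    ((∑ p, signOf (f p ∈ C i)) / (2 ^ k * L)) (v i)
  have h7 := abs_sub_le ((∑ p, signOf (f p ∈ C i)) / (2 ^ k * L))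
    (∑ a ∈ F, w a * signOf (a ∈ C i)) (v i)
  linarith

end VotingPruning

/-- **Pruning a voting classifier with margins (Lemma 4.5).**
If a convex combination `v = ∑_{h ∈ H} α_h · h` of hypotheses from a class `H`
of dual VC dimension at most `d*` has margin `v(xᵢ)·yᵢ ≥ θ` on every example,
then there are `L = ⌈130²·(4d* + 2)/θ²⌉` hypotheses `h₁, …, h_L ∈ H`, each with
`α_{h_j} > 0`, whose plain average is correct on every example. -/
theorem pruning_voting_classifier {X : Type*} (n : ℕ) (hn : 0 < n)
    (θ : ℝ) (hθ : 0 < θ)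
    (x : Fin n → X) (y : Fin n → ℝ) (hy : ∀ i, y i = 1 ∨ y i = -1)
    (H : Set (X → ℝ)) (hHc : H.Countable)
    (hHpm : ∀ h ∈ H, ∀ x', h x' = 1 ∨ h x' = -1)
    (dstar : ℕ)
    (hdual : ∀ s : Finset ↥H, Shatters (dualClass H) s → s.card ≤ dstar)
    (α : (X → ℝ) → ℝ) (hα0 : ∀ h, 0 ≤ α h) (hαsupp : ∀ h ∉ H, α h = 0)
    (hα1 : HasSum α 1)
    (hmargin : ∀ i, (∑' h : X → ℝ, α h * h (x i)) * y i ≥ θ) :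
    ∃ g : Fin (⌈((130 : ℝ) ^ 2 * (4 * dstar + 2)) / θ ^ 2⌉₊) → X → ℝ,
      (∀ j, g j ∈ H) ∧ (∀ j, 0 < α (g j)) ∧
      ∀ i, ((1 / (⌈((130 : ℝ) ^ 2 * (4 * dstar + 2)) / θ ^ 2⌉₊ : ℝ)) *
          ∑ j, g j (x i)) * y i > 0 := by
  classical
  let A := {h : X → ℝ | h ∈ H ∧ 0 < α h}
  let C : Fin n → Set A := fun i => {h | h.1 (x i) = 1}
  have hsign : ∀ (i : Fin n) (h : A), VotingPruning.signOf (h ∈ C i) = h.1 (x i) := by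
    intro i h
    rcases hHpm h.1 h.2.1 (x i) with h1 | h1
    · simp [VotingPruning.signOf, C, h1]
    · have : ¬ ((-1 : ℝ) = 1) := by norm_num
      simp [VotingPruning.signOf, C, h1, this]
  have hC : ∀ s : Finset A, (∀ t ⊆ s, ∃ i, ∀ a ∈ s, a ∈ C i ↔ a ∈ t) → s.card ≤ dstar + 1 := by
    intro s hs
    let φ : A ↪ ↥H := ⟨fun a => ⟨a.1, a.2.1⟩, fun a b hab => Subtype.ext (congrArg (·.1) hab)⟩
    rw [← Finset.card_map φ]
    refine (hdual _ fun σ => ?_).trans (Nat.le_succ _)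
    obtain ⟨i, hi⟩ := hs {a ∈ s | σ (φ a) = true} (Finset.filter_subset _ _)
    refine ⟨fun h => h.1 (x i), ⟨x i, rfl⟩, fun h hh => ?_⟩
    obtain ⟨a, ha, rfl⟩ := Finset.mem_map.1 hh
    have h1 : a ∈ C i ↔ σ (φ a) = true := by simpa [ha] using hi a ha
    rw [← if_congr h1 rfl rfl]
    exact (hsign i a).symm
  have hsupp : Function.support α ⊆ A := by
    intro h hh
    refine ⟨by_contra fun h' => hh (hαsupp h h'), lt_of_le_of_ne (hα0 h) (Ne.symm hh)⟩
  have hw1 : HasSum (fun a : A => α a) 1 := (hasSum_subtype_iff_of_support_subset hsupp).2 hα1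
  have hv : ∀ i, HasSum (fun a : A => α a * VotingPruning.signOf (a ∈ C i))
      (∑' h : X → ℝ, α h * h (x i)) := by
    intro i
    simp only [hsign]
    have hsm : Summable fun h : X → ℝ => α h * h (x i) := by
      refine Summable.of_norm_bounded hα1.summable fun h => ?_
      by_cases hh : h ∈ H
      · rw [Real.norm_eq_abs, abs_mul, abs_of_nonneg (hα0 h)]
        rcases hHpm h hh (x i) with h1 | h1 <;> simp [h1]
      · simp [hαsupp h hh]
    refine (hasSum_subtype_iff_of_support_subset (s := A) (f := fun h : X → ℝ => α h * h (x i))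
      ?_).2 hsm.hasSum
    exact (Function.support_mul_subset_left _ _).trans hsupp
  set L := ⌈((130 : ℝ) ^ 2 * (4 * dstar + 2)) / θ ^ 2⌉₊ with hLdef
  have hL : 0 < L := Nat.ceil_pos.2 (by positivity)
  have hL0 : (0 : ℝ) < L := by exact_mod_cast hL
  have hLle : ((130 : ℝ) ^ 2 * (4 * dstar + 2)) / θ ^ 2 ≤ L := Nat.le_ceil _
  obtain ⟨g, hg⟩ := VotingPruning.exists_sample C (dstar + 1) (Nat.succ_pos _) hC
    (fun a : A => α a) (fun a => hα0 a) hw1 _ hv L hL (θ / 10) (by positivity)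
  have hsqrt : 140 * √(((dstar + 1 : ℕ) : ℝ) / L) ≤ 4 / 5 * θ := by
    have : √(((dstar + 1 : ℕ) : ℝ) / L) ≤ θ / 175 := by
      apply Real.sqrt_le_iff.2
      refine ⟨by positivity, ?_⟩
      rw [div_le_iff₀ (by positivity)] at hLle
      rw [div_le_iff₀ hL0]
      push_cast
      have : (0 : ℝ) ≤ dstar := Nat.cast_nonneg _
      nlinarith
    linarith
  refine ⟨fun j => (g j).1, fun j => (g j).2.1, fun j => (g j).2.2, fun i => ?_⟩
  have h1 := hg i
  simp only [hsign] at h1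
  have h2 := hmargin i
  rw [one_div_mul_eq_div]
  have h3 := abs_le.1 h1
  rcases hy i with h | h <;> rw [h] at h2 ⊢ <;> linarith
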